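/- For every fixed real α with 1/6 ≤ α < (52 − 16√3)/121 there exist a real β > 0 and n₀ such that for all integers n ≥ n₀ there is a simple graph R on ⌊((√α + 1)² + β)·n⌋ vertices such that R contains no book B_{⌈αn⌉} and the complement of R contains no book B_n; that is, r(B_{⌈αn⌉}, B_n) > ((√α + 1)² + β)·n, so the random lower bound (√α + 1)²·n is not asymptotically tight in this interval. -/

import Mathlib

/-- A simple graph `G` contains the book `B_m`: two adjacent vertices with at
least `m` common neighbors. -/
def HasBook {V : Type*} (G : SimpleGraph V) (m : ℕ) : Prop :=
  ∃ u v : V, G.Adj u v ∧ m ≤ ({w | G.Adj u w ∧ G.Adj v w} : Set V).ncard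

/-- For independent Bernoulli variables, the probability that all coordinates in `S` equal `c`. -/
lemma sum_prod_weight_mul_prod_indicator {E : Type*} [Fintype E] [DecidableEq E]
    (p : Bool → ℝ) (hp : p true + p false = 1) (c : Bool) (S : Finset E) :
    ∑ ω : E → Bool, (∏ e, p (ω e)) * ∏ e ∈ S, (if ω e = c then (1 : ℝ) else 0)
      = p c ^ S.card := by
  have h := Finset.prod_univ_sum (fun _ : E => (Finset.univ : Finset Bool))
    (fun e b => p b * (if e ∈ S then (if b = c then (1 : ℝ) else 0) else 1))
  rw [Fintype.piFinset_univ] at h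
  have h1 : ∀ e : E, ∑ b : Bool, p b * (if e ∈ S then (if b = c then (1 : ℝ) else 0) else 1)
      = if e ∈ S then p c else 1 := by
    intro e
    by_cases he : e ∈ S
    · cases c <;> simp [he]
    · simp [he, hp]
  simp only [h1, Finset.prod_mul_distrib, Finset.prod_ite_mem, Finset.univ_inter,
    Finset.prod_const] at h
  exact h.symm

/-- The number of indices `i ∈ C` such that `ω` equals `c` on all of `S i`. -/
def monoCount {E ι : Type*} [DecidableEq E] (c : Bool) (C : Finset ι)
    (S : ι → Finset E) (ω : E → Bool) : ℕ :=
  (C.filter fun i => ∀ e ∈ S i, ω e = c).card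

lemma exp_monoCount {E ι : Type*} [DecidableEq E] (c : Bool) (C : Finset ι)
    (S : ι → Finset E) (ω : E → Bool) (t : ℝ) :
    Real.exp (t * monoCount c C S ω)
      = ∏ i ∈ C, (1 + (Real.exp t - 1) * ∏ e ∈ S i, (if ω e = c then (1 : ℝ) else 0)) := by
  have h : ∀ i ∈ C, (1 + (Real.exp t - 1) * ∏ e ∈ S i, (if ω e = c then (1 : ℝ) else 0))
      = if ∀ e ∈ S i, ω e = c then Real.exp t else 1 := by
    intro i _
    rw [Finset.prod_ite_zero]
    split_ifs <;> simp
  rw [Finset.prod_congr rfl h, ← Finset.prod_filter, Finset.prod_const, monoCount, mul_comm,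
    Real.exp_nat_mul]

/-- The moment generating function of `monoCount` for disjoint sets of equal size. -/
lemma sum_weight_mul_exp_monoCount {E ι : Type*} [Fintype E] [DecidableEq E] [DecidableEq ι]
    (p : Bool → ℝ) (hp : p true + p false = 1) (c : Bool) (C : Finset ι) (S : ι → Finset E)
    (d : ℕ) (hd : ∀ i ∈ C, (S i).card = d) (hS : (C : Set ι).PairwiseDisjoint S) (t : ℝ) :
    ∑ ω : E → Bool, (∏ e, p (ω e)) * Real.exp (t * monoCount c C S ω)
      = (1 + (Real.exp t - 1) * p c ^ d) ^ C.card := by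
  have key : ∀ T ∈ C.powerset, ∑ ω : E → Bool, (∏ e, p (ω e)) *
      ∏ i ∈ T, ((Real.exp t - 1) * ∏ e ∈ S i, (if ω e = c then (1 : ℝ) else 0))
      = ∏ i ∈ T, ((Real.exp t - 1) * p c ^ d) := by
    intro T hT
    have hTC := Finset.mem_powerset.1 hT
    have hdisj : (T : Set ι).PairwiseDisjoint S := hS.subset (by exact_mod_cast hTC)
    have hcard : (T.biUnion S).card = T.card * d := by
      rw [Finset.card_biUnion hdisj, Finset.sum_congr rfl fun i hi => hd i (hTC hi)]
      simp
    have h := sum_prod_weight_mul_prod_indicator p hp c (T.biUnion S)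
    rw [hcard] at h
    simp only [Finset.prod_mul_distrib, Finset.prod_const, ← Finset.prod_biUnion hdisj]
    rw [← pow_mul, mul_comm d, ← h, Finset.mul_sum]
    exact Finset.sum_congr rfl fun ω _ => by ring
  simp only [exp_monoCount, Finset.prod_one_add, Finset.mul_sum]
  rw [Finset.sum_comm, Finset.sum_congr rfl key, ← Finset.prod_one_add, Finset.prod_const]

/-- A Chernoff bound combined with a union bound. -/
lemma exists_monoCount_le {E ι J : Type*} [Fintype E] [DecidableEq E] [DecidableEq ι]
    [Fintype J] (p : Bool → ℝ) (hp0 : ∀ b, 0 ≤ p b) (hp : p true + p false = 1)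
    (c : J → Bool) (C : Finset ι) (S : J → ι → Finset E) (d : J → ℕ)
    (hd : ∀ j, ∀ i ∈ C, (S j i).card = d j)
    (hS : ∀ j, (C : Set ι).PairwiseDisjoint (S j)) (δ : ℝ) (hδ0 : 0 < δ) (hδ1 : δ ≤ 1)
    (hJ : Fintype.card J * Real.exp (-(δ ^ 2 / 4 * C.card)) < 1) :
    ∃ ω : E → Bool, ∀ j, (monoCount (c j) C (S j) ω : ℝ) ≤ (p (c j) ^ d j + δ) * C.card := by
  by_contra! hcon
  have hple : ∀ b, p b ≤ 1 := by
    intro b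
    have := hp0 true
    have := hp0 false
    cases b <;> linarith
  have htotal : ∑ ω : E → Bool, ∏ e, p (ω e) = 1 := by
    simpa using sum_prod_weight_mul_prod_indicator (E := E) p hp true ∅
  set t : ℝ := δ / 2 with ht
  have hj : ∀ j, ∑ ω : E → Bool, (∏ e, p (ω e)) *
      Real.exp (t * monoCount (c j) C (S j) ω - t * ((p (c j) ^ d j + δ) * C.card))
      ≤ Real.exp (-(δ ^ 2 / 4 * C.card)) := by
    intro j
    have hx0 : 0 ≤ p (c j) ^ d j := pow_nonneg (hp0 _) _
    have hx1 : p (c j) ^ d j ≤ 1 := pow_le_one₀ (hp0 _) (hple _)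
    have hexp : Real.exp t - 1 ≤ t + t ^ 2 := by
      have := (abs_le.1 (Real.abs_exp_sub_one_sub_id_le (x := t)
        (by rw [abs_of_pos (by positivity)]; linarith))).2
      linarith
    have hexp0 : 0 ≤ Real.exp t - 1 := by
      have := Real.add_one_le_exp t
      have : 0 < t := by positivity
      linarith
    have hbase : 1 + (Real.exp t - 1) * p (c j) ^ d j ≤ Real.exp (t * p (c j) ^ d j + t ^ 2) := by
      refine le_trans ?_ (Real.add_one_le_exp _)
      nlinarith [mul_le_mul_of_nonneg_right hexp hx0, sq_nonneg t]
    simp only [Real.exp_sub, ← mul_div_assoc]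
    rw [← Finset.sum_div, sum_weight_mul_exp_monoCount p hp (c j) C (S j) (d j) (hd j) (hS j),
      div_le_iff₀ (Real.exp_pos _), ← Real.exp_add]
    refine (pow_le_pow_left₀ (by positivity) hbase _).trans ?_
    rw [← Real.exp_nat_mul]
    apply le_of_eq
    congr 1
    rw [ht]
    ring
  have hsum : ∑ ω : E → Bool, (∏ e, p (ω e)) * ∑ j,
      Real.exp (t * monoCount (c j) C (S j) ω - t * ((p (c j) ^ d j + δ) * C.card)) < 1 := by
    simp only [Finset.mul_sum]
    rw [Finset.sum_comm]
    refine lt_of_le_of_lt (Finset.sum_le_sum fun j _ => hj j) ?_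
    simpa using hJ
  refine absurd hsum (not_lt.2 ?_)
  rw [← htotal]
  refine Finset.sum_le_sum fun ω _ => ?_
  refine le_mul_of_one_le_right (Finset.prod_nonneg fun e _ => hp0 _) ?_
  obtain ⟨j, hjω⟩ := hcon ω
  refine le_trans ?_ (Finset.single_le_sum (f := fun j =>
    Real.exp (t * monoCount (c j) C (S j) ω - t * ((p (c j) ^ d j + δ) * C.card)))
    (fun j _ => (Real.exp_pos _).le) (Finset.mem_univ j))
  refine Real.one_le_exp ?_
  have : 0 ≤ t := by positivity
  have := mul_le_mul_of_nonneg_left hjω.le this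
  linarith

/-- A colouring of the pairs of `Fin 3 × Fin m` in which degrees and codegrees into each part are
close to those of a random colouring with densities `p`. -/
lemma exists_tripartite_coloring (p : Bool → ℝ) (hp0 : ∀ b, 0 ≤ p b)
    (hp : p true + p false = 1) (δ : ℝ) (hδ0 : 0 < δ) (hδ1 : δ ≤ 1) :
    ∃ m₀ : ℕ, ∀ m, m₀ ≤ m → ∃ ω : Sym2 (Fin 3 × Fin m) → Bool,
      ∀ (c : Bool) (a b : Fin 3 × Fin m) (k : Fin 3), a.1 ≠ k → b.1 ≠ k →
        ((Finset.univ.filter fun i : Fin m => ω s(a, (k, i)) = c ∧ ω s(b, (k, i)) = c).card : ℝ)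
          ≤ (p c ^ ({a, b} : Finset (Fin 3 × Fin m)).card + δ) * m := by
  have hlim : Filter.Tendsto (fun m : ℕ => 54 * ((m : ℝ) ^ 2 * Real.exp (-(δ ^ 2 / 4 * m))))
      Filter.atTop (nhds (54 * 0)) := by
    refine Filter.Tendsto.const_mul _ ?_
    have h := (Real.tendsto_pow_mul_exp_neg_atTop_nhds_zero 2).comp
      ((tendsto_natCast_atTop_atTop (R := ℝ)).const_mul_atTop
        (show (0 : ℝ) < δ ^ 2 / 4 by positivity))
    have h2 := h.const_mul ((δ ^ 2 / 4) ^ 2)⁻¹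
    rw [mul_zero] at h2
    refine h2.congr fun m => ?_
    simp only [Function.comp_apply]
    field_simp
  rw [mul_zero] at hlim
  obtain ⟨m₀, hm₀⟩ := Filter.eventually_atTop.1 (hlim.eventually (gt_mem_nhds one_pos))
  refine ⟨m₀, fun m hm => ?_⟩
  let J := {x : Bool × (Fin 3 × Fin m) × (Fin 3 × Fin m) × Fin 3 //
    x.2.1.1 ≠ x.2.2.2 ∧ x.2.2.1.1 ≠ x.2.2.2}
  have hJcard : (Fintype.card J : ℝ) ≤ 54 * (m : ℝ) ^ 2 := by
    have h : Fintype.card J ≤ 54 * m ^ 2 := by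
      refine (Fintype.card_subtype_le _).trans (le_of_eq ?_)
      simp only [Fintype.card_prod, Fintype.card_bool, Fintype.card_fin]
      ring
    exact_mod_cast h
  let S : J → Fin m → Finset (Sym2 (Fin 3 × Fin m)) := fun j i =>
    ({j.1.2.1, j.1.2.2.1} : Finset (Fin 3 × Fin m)).image fun x => s(x, (j.1.2.2.2, i))
  have hne : ∀ j : J, ∀ x ∈ ({j.1.2.1, j.1.2.2.1} : Finset (Fin 3 × Fin m)),
      x.1 ≠ j.1.2.2.2 := by
    intro j x hx
    rcases Finset.mem_insert.1 hx with rfl | hx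
    · exact j.2.1
    · rw [Finset.mem_singleton.1 hx]
      exact j.2.2
  obtain ⟨ω, hω⟩ := exists_monoCount_le p hp0 hp (fun j : J => j.1.1)
    (Finset.univ : Finset (Fin m)) S
    (fun j => ({j.1.2.1, j.1.2.2.1} : Finset (Fin 3 × Fin m)).card)
    (fun j i _ => Finset.card_image_of_injective _ fun x y hxy => Sym2.congr_left.1 hxy)
    (fun j i _ i' _ hii' => by
      refine Finset.disjoint_left.2 fun e he he' => ?_
      obtain ⟨x, hx, rfl⟩ := Finset.mem_image.1 he
      obtain ⟨y, hy, hxy⟩ := Finset.mem_image.1 he'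
      rcases Sym2.eq_iff.1 hxy with ⟨_, h⟩ | ⟨h, _⟩
      · exact hii' (congrArg Prod.snd h).symm
      · exact hne j y hy (congrArg Prod.fst h))
    δ hδ0 hδ1 (by
      refine lt_of_le_of_lt ?_ (hm₀ m hm)
      rw [Finset.card_univ, Fintype.card_fin, ← mul_assoc]
      exact mul_le_mul_of_nonneg_right hJcard (Real.exp_pos _).le)
  refine ⟨ω, fun c a b k ha hb => ?_⟩
  have h := hω ⟨(c, a, b, k), ha, hb⟩
  simpa [monoCount, S] using h

lemma HasBook.of_comap {V W : Type*} [Finite W] {G : SimpleGraph W} (f : V ↪ W) {m : ℕ}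
    (h : HasBook (G.comap f) m) : HasBook G m := by
  obtain ⟨u, v, huv, hm⟩ := h
  refine ⟨f u, f v, huv, hm.trans ?_⟩
  rw [← Set.ncard_image_of_injective _ f.injective]
  refine Set.ncard_le_ncard ?_ (Set.toFinite _)
  rintro _ ⟨w, hw, rfl⟩
  exact hw

lemma HasBook.of_compl_comap {V W : Type*} [Finite W] {G : SimpleGraph W} (f : V ↪ W) {m : ℕ}
    (h : HasBook (G.comap f)ᶜ m) : HasBook Gᶜ m := by
  refine HasBook.of_comap f (m := m) ?_
  convert h using 1
  ext u v
  simp [f.injective.eq_iff]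

lemma ncard_setOf_prod {m : ℕ} (P : Fin 3 × Fin m → Prop) [DecidablePred P] :
    ({w | P w} : Set (Fin 3 × Fin m)).ncard
      = ∑ k, (Finset.univ.filter fun i : Fin m => P (k, i)).card := by
  rw [Set.ncard_eq_toFinset_card', Set.toFinset_ofPred]
  simp only [Finset.card_filter]
  exact Fintype.sum_prod_type _

lemma cast_card_filter_mono {ι : Type*} [Fintype ι] {P Q : ι → Prop} [DecidablePred P]
    [DecidablePred Q] (h : ∀ i, P i → Q i) :
    ((Finset.univ.filter P).card : ℝ) ≤ ((Finset.univ.filter Q).card : ℝ) :=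
  Nat.cast_le.2 (Finset.card_le_card (Finset.monotone_filter_right _ fun i _ => h i))

lemma sum_fin_three_ite (x : Fin 3) (z w : ℝ) :
    ∑ k : Fin 3, (if k = x then z else w) = z + 2 * w := by
  fin_cases x <;> simp [Fin.sum_univ_three] <;> ring

lemma sum_fin_three_ite_pair {x y : Fin 3} (hxy : x ≠ y) (z w : ℝ) :
    ∑ k : Fin 3, (if k = x ∨ k = y then z else w) = 2 * z + w := by
  revert hxy
  fin_cases x <;> fin_cases y <;> simp [Fin.sum_univ_three] <;> ring

/-- The tripartite graph whose edges are the pairs coloured `true` between different parts. -/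
def tripartiteGraph {m : ℕ} (ω : Sym2 (Fin 3 × Fin m) → Bool) : SimpleGraph (Fin 3 × Fin m) where
  Adj a b := a.1 ≠ b.1 ∧ ω s(a, b) = true
  symm := ⟨fun a b h => ⟨h.1.symm, by rw [Sym2.eq_swap]; exact h.2⟩⟩
  loopless := ⟨fun a h => h.1 rfl⟩

lemma tripartiteGraph_compl_adj {m : ℕ} {ω : Sym2 (Fin 3 × Fin m) → Bool} {a b : Fin 3 × Fin m}
    (h : (tripartiteGraph ω)ᶜ.Adj a b) (hab : a.1 ≠ b.1) : ω s(a, b) = false := by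
  have h2 := ((SimpleGraph.compl_adj _ _ _).1 h).2
  by_contra hω
  exact h2 ⟨hab, by simpa using hω⟩

/-- For every density `q`, a tripartite graph whose books and co-books are of about the size
expected in a random tripartite graph of density `q`. -/
lemma exists_tripartite_graph (q : ℝ) (hq0 : 0 ≤ q) (hq1 : q ≤ 1) (δ : ℝ) (hδ0 : 0 < δ)
    (hδ1 : δ ≤ 1) :
    ∃ m₀ : ℕ, ∀ m, m₀ ≤ m → ∃ G : SimpleGraph (Fin 3 × Fin m),
      (∀ r : ℕ, (q ^ 2 + δ) * m < r → ¬ HasBook G r) ∧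
      (∀ r : ℕ, (1 + 2 * ((1 - q) ^ 2 + δ)) * m < r →
        (2 * ((1 - q) + δ) + ((1 - q) ^ 2 + δ)) * m < r → ¬ HasBook Gᶜ r) := by
  classical
  obtain ⟨m₀, hm₀⟩ := exists_tripartite_coloring (fun b => if b then q else 1 - q)
    (by intro b; cases b <;> simp [hq0, hq1]) (by simp) δ hδ0 hδ1
  refine ⟨m₀, fun m hm => ?_⟩
  obtain ⟨ω, hω⟩ := hm₀ m hm
  refine ⟨tripartiteGraph ω, fun r hr => ?_, fun r hr1 hr2 => ?_⟩
  · rintro ⟨a, b, hab, hcard⟩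
    have hne : a ≠ b := hab.ne
    have hparts : a.1 ≠ b.1 := hab.1
    rw [ncard_setOf_prod] at hcard
    have hbound : ∀ k : Fin 3, ((Finset.univ.filter fun i : Fin m =>
        (tripartiteGraph ω).Adj a (k, i) ∧ (tripartiteGraph ω).Adj b (k, i)).card : ℝ)
        ≤ if k = a.1 ∨ k = b.1 then 0 else (q ^ 2 + δ) * m := by
      intro k
      split_ifs with hk
      · rw [Finset.filter_false_of_mem]
        · simp
        · rintro i - ⟨h1, h2⟩
          rcases hk with hk | hk
          · exact h1.1 hk.symm
          · exact h2.1 hk.symm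
      · push Not at hk
        have h := hω true a b k hk.1.symm hk.2.symm
        rw [Finset.card_pair hne] at h
        simp only [if_true] at h
        refine le_trans ?_ h
        exact cast_card_filter_mono fun i h => ⟨h.1.2, h.2.2⟩
    have hsum := Finset.sum_le_sum fun k (_ : k ∈ Finset.univ) => hbound k
    rw [sum_fin_three_ite_pair hparts] at hsum
    have : (r : ℝ) ≤ _ := Nat.cast_le.2 hcard
    push_cast at this
    linarith
  · rintro ⟨a, b, hab, hcard⟩
    have hne : a ≠ b := hab.ne
    rw [ncard_setOf_prod] at hcard
    have hcast : (r : ℝ) ≤ _ := Nat.cast_le.2 hcard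
    push_cast at hcast
    have hcodeg : ∀ k : Fin 3, a.1 ≠ k → b.1 ≠ k → ((Finset.univ.filter fun i : Fin m =>
        (tripartiteGraph ω)ᶜ.Adj a (k, i) ∧ (tripartiteGraph ω)ᶜ.Adj b (k, i)).card : ℝ)
        ≤ ((1 - q) ^ 2 + δ) * m := by
      intro k hak hbk
      have h := hω false a b k hak hbk
      rw [Finset.card_pair hne] at h
      simp only [Bool.false_eq_true, if_false] at h
      refine le_trans ?_ h
      exact cast_card_filter_mono fun i h =>
        ⟨tripartiteGraph_compl_adj h.1 hak, tripartiteGraph_compl_adj h.2 hbk⟩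
    have hdeg : ∀ (x : Fin 3 × Fin m) (k : Fin 3), x.1 ≠ k →
        ((Finset.univ.filter fun i : Fin m => (tripartiteGraph ω)ᶜ.Adj x (k, i)).card : ℝ)
        ≤ ((1 - q) + δ) * m := by
      intro x k hxk
      have h := hω false x x k hxk hxk
      simp only [Finset.pair_eq_singleton, Finset.card_singleton, pow_one, Bool.false_eq_true,
        if_false, and_self] at h
      refine le_trans ?_ h
      exact cast_card_filter_mono fun i h => tripartiteGraph_compl_adj h hxk
    by_cases hparts : a.1 = b.1
    · have hbound : ∀ k : Fin 3, ((Finset.univ.filter fun i : Fin m =>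
          (tripartiteGraph ω)ᶜ.Adj a (k, i) ∧ (tripartiteGraph ω)ᶜ.Adj b (k, i)).card : ℝ)
          ≤ if k = a.1 then (m : ℝ) else ((1 - q) ^ 2 + δ) * m := by
        intro k
        split_ifs with hk
        · exact_mod_cast (Finset.card_le_univ _).trans_eq (Fintype.card_fin m)
        · exact hcodeg k (Ne.symm hk) (hparts ▸ Ne.symm hk)
      have hsum := Finset.sum_le_sum fun k (_ : k ∈ Finset.univ) => hbound k
      rw [sum_fin_three_ite] at hsum
      linarith
    · have hbound : ∀ k : Fin 3, ((Finset.univ.filter fun i : Fin m =>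
          (tripartiteGraph ω)ᶜ.Adj a (k, i) ∧ (tripartiteGraph ω)ᶜ.Adj b (k, i)).card : ℝ)
          ≤ if k = a.1 ∨ k = b.1 then ((1 - q) + δ) * m else ((1 - q) ^ 2 + δ) * m := by
        intro k
        split_ifs with hk
        · rcases hk with rfl | rfl
          · refine le_trans ?_ (hdeg b a.1 (Ne.symm hparts))
            exact cast_card_filter_mono fun i h => h.2
          · refine le_trans ?_ (hdeg a b.1 hparts)
            exact cast_card_filter_mono fun i h => h.1
        · push Not at hk
          exact hcodeg k hk.1.symm hk.2.symm
      have hsum := Finset.sum_le_sum fun k (_ : k ∈ Finset.univ) => hbound k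
      rw [sum_fin_three_ite_pair hparts] at hsum
      linarith

/-- Admissible density `q`, relative part size `W` and error `δ` for the tripartite graph. -/
lemma exists_density_parameters (α : ℝ) (hα1 : 1/6 ≤ α)
    (hα2 : α < (52 - 16 * Real.sqrt 3) / 121) :
    ∃ q W δ : ℝ, 0 ≤ q ∧ q ≤ 1 ∧ 0 < δ ∧ δ ≤ 1 ∧ (Real.sqrt α + 1) ^ 2 < 3 * W ∧
      (q ^ 2 + δ) * W < α ∧ (1 + 2 * ((1 - q) ^ 2 + δ)) * W < 1 ∧
      (2 * ((1 - q) + δ) + ((1 - q) ^ 2 + δ)) * W < 1 := by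
  set s := Real.sqrt 3 with hs
  have hs2 : s ^ 2 = 3 := Real.sq_sqrt (by norm_num)
  have hs0 : 0 ≤ s := Real.sqrt_nonneg 3
  have hsl : 1.73 < s := by
    rw [hs]
    exact Real.lt_sqrt_of_sq_lt (by norm_num)
  have hsu : s < 1.74 := by
    rw [hs, Real.sqrt_lt' (by norm_num)]
    norm_num
  set a := Real.sqrt α with ha
  have ha2 : a ^ 2 = α := Real.sq_sqrt (by linarith)
  have ha0 : 0 < a := Real.sqrt_pos.2 (by linarith)
  have hau : a < (4 * s - 2) / 11 := by
    rw [ha, Real.sqrt_lt' (by linarith)]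
    refine hα2.trans_eq ?_
    field_simp
    nlinarith
  set q₀ := a * s / (1 + a) with hq₀
  set w := (a + 1) ^ 2 / 3 with hw
  have hw0 : 0 < w := by positivity
  have hq₀pos : 0 < q₀ := by positivity
  have hq₀lt : q₀ < 1 := by
    rw [hq₀, div_lt_one (by positivity)]
    nlinarith
  have hred : q₀ ^ 2 * w = α := by
    rw [hq₀, hw, ← ha2]
    field_simp
    rw [hs2]
    ring
  have hlin : q₀ * w = a * s * (a + 1) / 3 := by
    rw [hq₀, hw]
    field_simp
    ring
  have hblue : (1 + 2 * (1 - q₀) ^ 2) * w < 1 := by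
    have : (1 + 2 * (1 - q₀) ^ 2) * w = 3 * w - 4 * (q₀ * w) + 2 * (q₀ ^ 2 * w) := by ring
    rw [this, hred, hlin, hw, ← ha2]
    have hfac : a * (9 - 4 * s) < 4 * s - 6 := by
      have h := mul_lt_mul_of_pos_right hau (show 0 < 9 - 4 * s by linarith)
      nlinarith
    nlinarith
  have hcross : (2 * (1 - q₀) + (1 - q₀) ^ 2) * w < 1 := by
    nlinarith [mul_nonneg (sq_nonneg q₀) hw0.le]
  obtain ⟨q, hq, hqlt, hqblue, hqcross⟩ : ∃ q, 0 < q ∧ q < q₀ ∧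
      (1 + 2 * (1 - q) ^ 2) * w < 1 ∧ (2 * (1 - q) + (1 - q) ^ 2) * w < 1 := by
    have h1 : ∀ᶠ q in nhds q₀, (1 + 2 * (1 - q) ^ 2) * w < 1 :=
      (by fun_prop : Continuous fun q : ℝ => (1 + 2 * (1 - q) ^ 2) * w).continuousAt.eventually
        (gt_mem_nhds hblue)
    have h2 : ∀ᶠ q in nhds q₀, (2 * (1 - q) + (1 - q) ^ 2) * w < 1 :=
      (by fun_prop : Continuous fun q : ℝ =>
        (2 * (1 - q) + (1 - q) ^ 2) * w).continuousAt.eventually (gt_mem_nhds hcross)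
    have h3 : ∀ᶠ q in nhds q₀, 0 < q := lt_mem_nhds hq₀pos
    have h := ((h3.and (h1.and h2)).filter_mono nhdsWithin_le_nhds).and
      (self_mem_nhdsWithin : ∀ᶠ q in nhdsWithin q₀ (Set.Iio q₀), q ∈ Set.Iio q₀)
    obtain ⟨q, ⟨h3, h1, h2⟩, h4⟩ := h.exists
    exact ⟨q, h3, h4, h1, h2⟩
  have hqred : q ^ 2 * w < α := by
    rw [← hred]
    exact mul_lt_mul_of_pos_right (pow_lt_pow_left₀ hqlt hq.le two_ne_zero) hw0
  have h1 : ∀ᶠ ε in nhds (0 : ℝ), (q ^ 2 + ε) * (w + ε) < α :=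
    (by fun_prop : Continuous fun ε : ℝ => (q ^ 2 + ε) * (w + ε)).continuousAt.eventually
      (gt_mem_nhds (by simpa using hqred))
  have h2 : ∀ᶠ ε in nhds (0 : ℝ), (1 + 2 * ((1 - q) ^ 2 + ε)) * (w + ε) < 1 :=
    (by fun_prop : Continuous fun ε : ℝ =>
      (1 + 2 * ((1 - q) ^ 2 + ε)) * (w + ε)).continuousAt.eventually
      (gt_mem_nhds (by simpa using hqblue))
  have h3 : ∀ᶠ ε in nhds (0 : ℝ), (2 * ((1 - q) + ε) + ((1 - q) ^ 2 + ε)) * (w + ε) < 1 :=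
    (by fun_prop : Continuous fun ε : ℝ =>
      (2 * ((1 - q) + ε) + ((1 - q) ^ 2 + ε)) * (w + ε)).continuousAt.eventually
      (gt_mem_nhds (by simpa using hqcross))
  have h4 : ∀ᶠ ε in nhds (0 : ℝ), ε < 1 := gt_mem_nhds one_pos
  have h := ((h1.and (h2.and (h3.and h4))).filter_mono nhdsWithin_le_nhds).and
    (self_mem_nhdsWithin : ∀ᶠ ε in nhdsWithin (0 : ℝ) (Set.Ioi 0), ε ∈ Set.Ioi 0)
  obtain ⟨ε, ⟨h1, h2, h3, h4⟩, h0⟩ := h.exists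
  have h0 : 0 < ε := h0
  exact ⟨q, w + ε, ε, hq.le, (hqlt.trans hq₀lt).le, h0, h4.le, by linarith, h1, h2, h3⟩

/-- For `1/6 ≤ α < (52 − 16√3)/121`, the random lower bound is not tight:
there is `β > 0` with `r(B_{⌈αn⌉}, B_n) > ((√α + 1)² + β) n` for all large `n`. -/
theorem ramsey_book_not_tight (α : ℝ) (hα1 : 1/6 ≤ α)
    (hα2 : α < (52 - 16 * Real.sqrt 3) / 121) :
    ∃ β : ℝ, 0 < β ∧ ∃ n₀ : ℕ, ∀ n : ℕ, n₀ ≤ n →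
      ∃ R : SimpleGraph (Fin ⌊((Real.sqrt α + 1) ^ 2 + β) * (n : ℝ)⌋₊),
        ¬ HasBook R ⌈α * (n : ℝ)⌉₊ ∧ ¬ HasBook Rᶜ n := by
  obtain ⟨q, W, δ, hq0, hq1, hδ0, hδ1, hW, hred, hblue, hcross⟩ :=
    exists_density_parameters α hα1 hα2
  obtain ⟨m₀, hm₀⟩ := exists_tripartite_graph q hq0 hq1 δ hδ0 hδ1
  have hWpos : 0 < W := by nlinarith [sq_nonneg (Real.sqrt α + 1)]
  set γ := W - (Real.sqrt α + 1) ^ 2 / 3 with hγ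
  have hγ0 : 0 < γ := by linarith
  obtain ⟨n₁, hn₁⟩ := exists_nat_gt (1 / γ)
  obtain ⟨n₂, hn₂⟩ := exists_nat_gt ((m₀ + 1) / W)
  refine ⟨γ, hγ0, max 1 (max n₁ n₂), fun n hn => ?_⟩
  have hn0 : (1 : ℝ) ≤ n := by exact_mod_cast (le_max_left _ _).trans hn
  have hnn₁ : (n₁ : ℝ) ≤ n := by
    exact_mod_cast (le_max_left _ _).trans ((le_max_right _ _).trans hn)
  have hnn₂ : (n₂ : ℝ) ≤ n := by
    exact_mod_cast (le_max_right _ _).trans ((le_max_right _ _).trans hn)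
  have hn1 : 1 < γ * n := by
    have := (div_lt_iff₀ hγ0).1 (hn₁.trans_le hnn₁)
    linarith
  have hn2 : (m₀ : ℝ) + 1 < W * n := by
    have := (div_lt_iff₀ hWpos).1 (hn₂.trans_le hnn₂)
    linarith
  set m := ⌊W * (n : ℝ)⌋₊ with hm
  have hmle : (m : ℝ) ≤ W * n := Nat.floor_le (by positivity)
  have hmlt : W * n < m + 1 := Nat.lt_floor_add_one _
  have hmm₀ : m₀ ≤ m := by
    have : (m₀ : ℝ) < m := by linarith
    exact_mod_cast this.le
  obtain ⟨G, hG, hGc⟩ := hm₀ m hmm₀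
  set N := ⌊((Real.sqrt α + 1) ^ 2 + γ) * (n : ℝ)⌋₊ with hN
  have hNle : N ≤ 3 * m := by
    have h1 : (N : ℝ) ≤ ((Real.sqrt α + 1) ^ 2 + γ) * n := Nat.floor_le (by positivity)
    have h2 : (Real.sqrt α + 1) ^ 2 + γ = 3 * W - 2 * γ := by rw [hγ]; ring
    rw [h2] at h1
    have h3 : (N : ℝ) < 3 * m + 1 := by nlinarith
    have h4 : N < 3 * m + 1 := by exact_mod_cast h3
    omega
  let f : Fin N ↪ Fin 3 × Fin m := (Fin.castLEEmb hNle).trans finProdFinEquiv.symm.toEmbedding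
  have hscale : ∀ x y : ℝ, 0 ≤ x → x * W < y → x * m < y * n := by
    intro x y hx hxy
    calc x * m ≤ x * (W * n) := mul_le_mul_of_nonneg_left hmle hx
      _ = x * W * n := by ring
      _ < y * n := mul_lt_mul_of_pos_right hxy (by linarith)
  have hq1' : 0 ≤ 1 - q := by linarith
  refine ⟨G.comap f, fun h => ?_, fun h => ?_⟩
  · exact hG _ ((hscale _ _ (by positivity) hred).trans_le (Nat.le_ceil _)) (h.of_comap f)
  · refine hGc n ?_ ?_ (h.of_compl_comap f)
    · simpa using hscale _ _ (by positivity) hblue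
    · simpa using hscale _ _ (by positivity) hcross
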